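/- For every positive integer r with r = 1, or r even with r ≥ 4, or r odd with r ≥ 7, the set ℳ_r contains an irreducible matrix. -/

import Mathlib

/-- The subspace 𝒱_n = {x ∈ (𝔽₂)^n : Σ xᵢ = 0}. -/
def VS (n : ℕ) : Submodule (ZMod 2) (Fin n → ZMod 2) where
  carrier := {x | ∑ i, x i = 0}
  add_mem' := by
    intro a b ha hb
    simp only [Set.mem_setOf_eq] at *
    simp [Finset.sum_add_distrib, ha, hb]
  zero_mem' := by simp
  smul_mem' := by
    intro c x hx
    simp only [Set.mem_setOf_eq, Pi.smul_apply, ← Finset.mul_sum, smul_eq_mul] at *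
    simp [hx]

lemma mem_VS {n : ℕ} (x : Fin n → ZMod 2) : x ∈ VS n ↔ ∑ i, x i = 0 := Iff.rfl

/-- 𝒱(v) = {x ∈ 𝒱_n : x∘v ∈ 𝒱_n}. -/
def VV {n : ℕ} (v : Fin n → ZMod 2) : Submodule (ZMod 2) (Fin n → ZMod 2) where
  carrier := {x | x ∈ VS n ∧ x * v ∈ VS n}
  add_mem' := by
    intro a b ha hb
    exact ⟨(VS n).add_mem ha.1 hb.1, by rw [add_mul]; exact (VS n).add_mem ha.2 hb.2⟩
  zero_mem' := ⟨(VS n).zero_mem, by rw [zero_mul]; exact (VS n).zero_mem⟩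
  smul_mem' := by
    intro c x hx
    exact ⟨(VS n).smul_mem c hx.1, by rw [smul_mul_assoc]; exact (VS n).smul_mem c hx.2⟩

lemma mem_VV {n : ℕ} (v x : Fin n → ZMod 2) : x ∈ VV v ↔ x ∈ VS n ∧ x * v ∈ VS n := Iff.rfl

/-- ℳ_r: 2r×r matrices over 𝔽₂ of rank r whose columns vᵢ satisfy vᵢ∘vⱼ ∈ 𝒱_{2r}. -/
def MemM (r : ℕ) (A : Matrix (Fin (2*r)) (Fin r) (ZMod 2)) : Prop :=
  A.rank = r ∧ ∀ j k : Fin r, (fun i => A i j * A i k) ∈ VS (2*r)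

/-- The permutation matrix of σ. -/
def permMat {n : ℕ} (σ : Equiv.Perm (Fin n)) : Matrix (Fin n) (Fin n) (ZMod 2) :=
  Matrix.of fun i j => if σ j = i then 1 else 0

/-- The 2r×r matrix with P stacked on top of Q. -/
def stack {r : ℕ} (P Q : Matrix (Fin r) (Fin r) (ZMod 2)) :
    Matrix (Fin (2*r)) (Fin r) (ZMod 2) :=
  Matrix.of fun i j =>
    if h : (i : ℕ) < r then P ⟨i, h⟩ j
    else Q ⟨(i : ℕ) - r, by have := i.isLt; omega⟩ j

/-- A ∼ B iff B = σAλ for a permutation matrix σ and λ ∈ GL(r,𝔽₂). -/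
def EquivMat (r : ℕ) (A B : Matrix (Fin (2*r)) (Fin r) (ZMod 2)) : Prop :=
  ∃ (σ : Equiv.Perm (Fin (2*r))) (lam : Matrix (Fin r) (Fin r) (ZMod 2)),
    IsUnit lam ∧ permMat σ * A * lam = B

/-- The span of the columns of A. -/
def colSpan {N r : ℕ} (A : Matrix (Fin N) (Fin r) (ZMod 2)) :
    Submodule (ZMod 2) (Fin N → ZMod 2) :=
  Submodule.span (ZMod 2) (Set.range fun j i => A i j)

/-- A ∈ ℳ_r is irreducible if the span of its columns admits no direct-sum
decomposition into more than one nonzero subspace with pairwise zero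
coordinatewise products. -/
def IrredMat {N r : ℕ} (A : Matrix (Fin N) (Fin r) (ZMod 2)) : Prop :=
  ¬ ∃ (l : ℕ) (W : Fin l → Submodule (ZMod 2) (Fin N → ZMod 2)),
      1 < l ∧ (∀ i, W i ≠ ⊥) ∧
      (∀ i j, i ≠ j → ∀ x ∈ W i, ∀ y ∈ W j, x * y = 0) ∧
      (⨆ i, W i) = colSpan A ∧
      (∀ i : Fin l, Disjoint (W i) (⨆ j ∈ ({i}ᶜ : Set (Fin l)), W j))

lemma z2 (a : ZMod 2) : a = 0 ∨ a = 1 := by revert a; decide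

lemma z2_mul_self (a : ZMod 2) : a * a = a := by revert a; decide

lemma sum_two_mul {r : ℕ} (f : Fin (2*r) → ZMod 2) :
    ∑ i, f i = ∑ i : Fin r, f ⟨i, by omega⟩ + ∑ i : Fin r, f ⟨r + i, by omega⟩ := by
  rw [← (finCongr (two_mul r).symm).sum_comp f, Fin.sum_univ_add]
  rfl

lemma stack_top {r : ℕ} (P Q : Matrix (Fin r) (Fin r) (ZMod 2)) (i j : Fin r) :
    stack P Q ⟨i, by omega⟩ j = P i j := by
  simp [stack]

lemma stack_bot {r : ℕ} (P Q : Matrix (Fin r) (Fin r) (ZMod 2)) (i j : Fin r) :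
    stack P Q ⟨r + i, by omega⟩ j = Q i j := by
  simp [stack]

lemma mulVec_top {r : ℕ} (Q : Matrix (Fin r) (Fin r) (ZMod 2)) (y : Fin r → ZMod 2) (i : Fin r) :
    (stack 1 Q).mulVec y ⟨i, by omega⟩ = y i := by
  simp [Matrix.mulVec, dotProduct, stack_top, Matrix.one_apply]

lemma memM_stack {r : ℕ} (Q : Matrix (Fin r) (Fin r) (ZMod 2)) (hQ : Q.transpose * Q = 1) :
    MemM r (stack 1 Q) := by
  constructor
  · have h : LinearIndependent (ZMod 2) (stack 1 Q).col := by
      rw [← Matrix.mulVec_injective_iff]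
      intro x y hxy
      funext i
      rw [← mulVec_top Q x i, ← mulVec_top Q y i, hxy]
    have h2 := LinearIndependent.rank_matrix (M := (stack 1 Q).transpose) h
    rw [Matrix.rank_transpose] at h2
    simpa using h2
  · intro j k
    rw [mem_VS, sum_two_mul]
    simp only [stack_top, stack_bot]
    have h1 : ∑ i, Q i j * Q i k = (1 : Matrix (Fin r) (Fin r) (ZMod 2)) j k := by
      rw [← hQ, Matrix.mul_apply]; rfl
    rw [h1]
    simp only [Matrix.one_apply, mul_ite, mul_one, mul_zero]
    by_cases hjk : j = k
    · subst hjk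
      simp
      decide
    · simp [hjk]
      intro h; exact hjk h.symm

lemma colSpan_top_zero {r : ℕ} (Q : Matrix (Fin r) (Fin r) (ZMod 2)) (x : Fin (2*r) → ZMod 2)
    (hx : x ∈ colSpan (stack 1 Q)) (h0 : ∀ i : Fin r, x ⟨i, by omega⟩ = 0) : x = 0 := by
  have : colSpan (stack 1 Q) = LinearMap.range (stack 1 Q).mulVecLin := by
    rw [Matrix.range_mulVecLin]; rfl
  rw [this] at hx
  obtain ⟨y, rfl⟩ := hx
  have hy : y = 0 := by
    funext i
    rw [← mulVec_top Q y i]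
    exact h0 i
  simp [hy]

lemma irred_stack {r : ℕ} (Q : Matrix (Fin r) (Fin r) (ZMod 2)) (c : Fin r)
    (hc : ∀ j, j ≠ c → ∃ i, Q i j = 1 ∧ Q i c = 1) : IrredMat (stack 1 Q) := by
  rintro ⟨l, W, hl, hne, hort, hsup, -⟩
  set A := stack 1 Q with hA
  have hWle : ∀ i, W i ≤ colSpan A := fun i => hsup ▸ le_iSup W i
  have key : ∀ j : Fin r, ∃ i, (fun k => A k j) ∈ W i := by
    intro j
    have hj : (fun k => A k j) ∈ ⨆ i, W i := by
      rw [hsup]; exact Submodule.subset_span ⟨j, rfl⟩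
    rw [Submodule.mem_iSup_iff_exists_finsupp] at hj
    obtain ⟨f, hf, hs⟩ := hj
    rw [Finsupp.sum_fintype _ _ (by simp)] at hs
    have hpt : ∀ i k, f i k * A k j = f i k := by
      intro i k
      have : A k j = ∑ i, f i k := by
        have := congrFun hs k
        simpa using this.symm
      rw [this, Finset.mul_sum, Finset.sum_eq_single i]
      · exact z2_mul_self _
      · intro b _ hb
        exact congrFun (hort i b (Ne.symm hb) _ (hf i) _ (hf b)) k
      · simp
    have hex : ∃ i0, f i0 ⟨j, by omega⟩ ≠ 0 := by
      by_contra hcon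
      push Not at hcon
      have := congrFun hs ⟨j, by omega⟩
      simp [hcon] at this
      rw [hA, stack_top] at this
      simp at this
    obtain ⟨i0, hi0⟩ := hex
    refine ⟨i0, ?_⟩
    have hz : ∀ i, i ≠ i0 → f i = 0 := by
      intro i hi
      apply colSpan_top_zero Q _ (hWle i (hf i))
      intro k
      by_cases hk : k = j
      · subst hk
        have := congrFun (hort i i0 hi _ (hf i) _ (hf i0)) ⟨k, by omega⟩
        simp only [Pi.mul_apply, Pi.zero_apply, mul_eq_zero] at this
        exact this.resolve_right hi0
      · rw [← hpt, hA, stack_top, Matrix.one_apply_ne hk, mul_zero]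
    rw [← hs, Finset.sum_eq_single i0 (fun b _ hb => hz b hb) (by simp)]
    exact hf i0
  obtain ⟨i0, hi0⟩ := key c
  have hall : ∀ j, (fun k => A k j) ∈ W i0 := by
    intro j
    by_cases hj : j = c
    · rw [hj]; exact hi0
    obtain ⟨i, hi⟩ := key j
    by_cases hii : i = i0
    · rw [← hii]; exact hi
    exfalso
    obtain ⟨k, h1, h2⟩ := hc j hj
    have := congrFun (hort i i0 hii _ hi _ hi0) ⟨r + k, by omega⟩
    simp only [Pi.mul_apply, hA, stack_bot, h1, h2] at this
    simp at this
  have hle : colSpan A ≤ W i0 := by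
    apply Submodule.span_le.2
    rintro _ ⟨j, rfl⟩
    exact hall j
  haveI : Nontrivial (Fin l) := Fin.nontrivial_iff_two_le.2 hl
  obtain ⟨i1, hi1⟩ := exists_ne i0
  apply hne i1
  rw [eq_bot_iff]
  intro x hx
  have := hort i1 i0 hi1 x hx x (hle (hWle i1 hx))
  rw [Submodule.mem_bot]
  funext k
  rw [← z2_mul_self (x k)]
  exact congrFun this k

/-- The reflection `1 + u uᵀ`. -/
def refl2 {r : ℕ} (u : Fin r → ZMod 2) : Matrix (Fin r) (Fin r) (ZMod 2) :=
  1 + Matrix.vecMulVec u u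

lemma refl2_transpose {r : ℕ} (u : Fin r → ZMod 2) : (refl2 u).transpose = refl2 u := by
  simp [refl2, Matrix.transpose_vecMulVec]

lemma refl2_sq {r : ℕ} (u : Fin r → ZMod 2) (hu : u ⬝ᵥ u = 0) : refl2 u * refl2 u = 1 := by
  have : Matrix.vecMulVec u u * Matrix.vecMulVec u u = 0 := by
    rw [Matrix.vecMulVec_mul_vecMulVec, hu]; simp
  rw [refl2, mul_add, add_mul, add_mul, this]
  ext i j
  simp only [Matrix.add_apply, one_mul, mul_one, Matrix.zero_apply]
  generalize (1 : Matrix (Fin r) (Fin r) (ZMod 2)) i j = a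
  generalize Matrix.vecMulVec u u i j = b
  revert a b; decide

lemma refl2_mul_orth {r : ℕ} (u v : Fin r → ZMod 2) (hu : u ⬝ᵥ u = 0) (hv : v ⬝ᵥ v = 0) :
    (refl2 u * refl2 v).transpose * (refl2 u * refl2 v) = 1 := by
  rw [Matrix.transpose_mul, refl2_transpose, refl2_transpose, mul_assoc, ← mul_assoc (refl2 u),
    refl2_sq u hu, one_mul, refl2_sq v hv]

lemma refl2_mul_apply {r : ℕ} (u v : Fin r → ZMod 2) (huv : u ⬝ᵥ v = 1) (i j : Fin r) :
    (refl2 u * refl2 v) i j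
      = (if i = j then 1 else 0) + u i * u j + v i * v j + u i * v j := by
  rw [refl2, refl2, mul_add, add_mul, add_mul, Matrix.vecMulVec_mul_vecMulVec, huv]
  simp [Matrix.vecMulVec_apply, Matrix.one_apply]
  ring

/-- for r = 1, for even r ≥ 4, and for odd r ≥ 7, ℳ_r contains an
irreducible matrix. -/
theorem stmt18 (r : ℕ)
    (h : r = 1 ∨ (Even r ∧ 4 ≤ r) ∨ (Odd r ∧ 7 ≤ r)) :
    ∃ A : Matrix (Fin (2*r)) (Fin r) (ZMod 2), MemM r A ∧ IrredMat A := by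
  rcases h with rfl | ⟨he, h4⟩ | ⟨ho, h7⟩
  · exact ⟨stack 1 1, memM_stack _ (by simp), irred_stack _ 0
      (fun j hj => absurd (Subsingleton.elim _ _) hj)⟩
  · refine ⟨stack 1 (refl2 1), memM_stack _ ?_, irred_stack _ ⟨0, by omega⟩ ?_⟩
    · rw [refl2_transpose, refl2_sq]
      simp [dotProduct]
      exact (ZMod.natCast_eq_zero_iff_even).2 he
    · intro j hj
      have : ∃ i : Fin r, i ≠ j ∧ i ≠ ⟨0, by omega⟩ := by
        by_cases h1 : j = ⟨1, by omega⟩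
        · exact ⟨⟨2, by omega⟩, by simp [h1], by simp⟩
        · exact ⟨⟨1, by omega⟩, Ne.symm h1, by simp⟩
      obtain ⟨i, hi1, hi2⟩ := this
      refine ⟨i, ?_, ?_⟩ <;>
        simp [refl2, Matrix.vecMulVec_apply, Matrix.one_apply_ne, hi1, hi2]
  · obtain ⟨k, rfl⟩ := Nat.exists_eq_add_of_le' h7
    have hk : Even k := by
      rw [Nat.odd_add'] at ho
      exact ho.1 (by decide)
    have hk0 : (k : ZMod 2) = 0 := (ZMod.natCast_eq_zero_iff_even).2 hk
    let u : Fin (k+7) → ZMod 2 := fun i => if (i : ℕ) < 4 then 1 else 0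
    let v : Fin (k+7) → ZMod 2 := fun i => if 3 ≤ (i : ℕ) then 1 else 0
    have hx : ∀ x : ℕ, ¬ (x + 1 + 1 + 1 + 1 + 1 + 1 + 1 < 4) := by intro x; omega
    have hu : u ⬝ᵥ u = 0 := by
      simp [dotProduct, u, Fin.sum_univ_succ, hx]
      try decide
    have hv : v ⬝ᵥ v = 0 := by
      simp [dotProduct, v, Fin.sum_univ_succ, hk0]
      try decide
    have huv : u ⬝ᵥ v = 1 := by
      rw [dotProduct, Finset.sum_eq_single ⟨3, by omega⟩]
      · simp [u, v]
      · intro b _ hb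
        have hb3 : (b : ℕ) ≠ 3 := fun h => hb (Fin.ext h)
        by_cases h4 : (b : ℕ) < 4
        · have : ¬ 3 ≤ (b : ℕ) := by omega
          simp [v, this]
        · simp [u, h4]
      · simp
    refine ⟨stack 1 (refl2 u * refl2 v), memM_stack _ (refl2_mul_orth u v hu hv),
      irred_stack _ ⟨4, by omega⟩ ?_⟩
    intro j hj
    have hj4 : (j : ℕ) ≠ 4 := fun h => hj (Fin.ext h)
    simp only [refl2_mul_apply u v huv, u, v, Fin.ext_iff]
    by_cases h0 : (j : ℕ) = 0
    · exact ⟨⟨1, by omega⟩, by simp [h0], by simp⟩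
    by_cases h3 : (j : ℕ) = 3
    · exact ⟨⟨5, by omega⟩, by simp [h3], by simp⟩
    refine ⟨⟨0, by omega⟩, ?_, by simp⟩
    by_cases h4 : (j : ℕ) < 4
    · have : ¬ 3 ≤ (j : ℕ) := by omega
      simp [h4, this, Ne.symm h0]
    · have : 3 ≤ (j : ℕ) := by omega
      simp [h4, this, Ne.symm h0]
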